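/- arXiv:2309.04941 — 4 statements merged into one kernel-verified Lean document; each statement's English description precedes it below -/
import Mathlib

section
/- For any two distinct vertices u, v of a finite simple graph G, the following identity holds in ℤ: P_4(u,v) = Σ_{y ∈ V, y ∉ {u,v}} |N(u)∩N(y)|·|N(y)∩N(v)| − Σ_{x ∈ N(u)∩N(v)} (deg(x) − 2) − [u~v]·(2·C_3(u) + 2·C_3(v) − 3·|N(u)∩N(v)|). -/
/-!
Counting quantities for a (finite) simple graph `G`:

* `walkCount G k u v` = `W_k(u,v)`, the number of `k`-walks from `u` to `v`;
* `pathCount G k u v` = `P_k(u,v)`, the number of `k`-paths from `u` to `v`;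
* `cycleWalkCount G ℓ u` = the number of closed walks of length `ℓ` based at `u`
  that are cycles; by definition `C_ℓ(u)` is half this number, so this quantity
  is exactly `2·C_ℓ(u)`;
* `triangleCount G u` = `C_3(u)`, the number of unordered pairs `{x,y} ⊆ N(u)`
  with `x` adjacent to `y` (equivalently, edges of `G` whose two endpoints are
  both neighbors of `u`);
* `pairPathCount G k l u v` = `C_{k,l}(u,v)`, the number of ordered pairs `(p,q)`
  where `p` is a `k`-path from `u` to `v`, `q` is an `l`-path from `u` to `v`,
  and `p`, `q` share no vertices other than `u` and `v`;
* `tailedTriangleCount G u v` = `T(u,v)`;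
* `triangleRectangleCount G u v` = `TR_1(u,v)`;
* `chordalCycleCount G u` = `CC_1(u)`;
* `pendantTailCount G u` = the number of tailed triangles with pendant vertex `u`.
-/

open SimpleGraph Finset

variable {V : Type*}

noncomputable def walkCount (G : SimpleGraph V) (k : ℕ) (u v : V) : ℕ :=
  Nat.card {p : G.Walk u v // p.length = k}

noncomputable def pathCount (G : SimpleGraph V) (k : ℕ) (u v : V) : ℕ :=
  Nat.card {p : G.Walk u v // p.length = k ∧ p.IsPath}

noncomputable def cycleWalkCount (G : SimpleGraph V) (ℓ : ℕ) (u : V) : ℕ :=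
  Nat.card {p : G.Walk u u // p.length = ℓ ∧ p.IsCycle}

noncomputable def triangleCount (G : SimpleGraph V) (u : V) : ℕ :=
  Nat.card {e : Sym2 V // e ∈ G.edgeSet ∧ ∀ x ∈ e, G.Adj u x}

noncomputable def pairPathCount (G : SimpleGraph V) (k l : ℕ) (u v : V) : ℕ :=
  Nat.card {pq : G.Walk u v × G.Walk u v //
    pq.1.length = k ∧ pq.1.IsPath ∧ pq.2.length = l ∧ pq.2.IsPath ∧
    ∀ w ∈ pq.1.support, w ∈ pq.2.support → w = u ∨ w = v}

noncomputable def tailedTriangleCount (G : SimpleGraph V) (u v : V) : ℕ :=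
  Nat.card {wz : V × V // wz.1 ≠ wz.2 ∧ wz.1 ≠ u ∧ wz.1 ≠ v ∧ wz.2 ≠ u ∧ wz.2 ≠ v ∧
    G.Adj wz.1 u ∧ G.Adj wz.1 v ∧ G.Adj wz.1 wz.2 ∧ G.Adj wz.2 v}

noncomputable def triangleRectangleCount (G : SimpleGraph V) (u v : V) : ℕ :=
  Nat.card {t : V × V × V //
    (t.1 ≠ t.2.1 ∧ t.1 ≠ t.2.2 ∧ t.2.1 ≠ t.2.2) ∧
    (t.1 ≠ u ∧ t.1 ≠ v ∧ t.2.1 ≠ u ∧ t.2.1 ≠ v ∧ t.2.2 ≠ u ∧ t.2.2 ≠ v) ∧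
    G.Adj u t.1 ∧ G.Adj v t.1 ∧ G.Adj v t.2.1 ∧ G.Adj t.2.1 t.2.2 ∧ G.Adj t.2.2 t.1}

noncomputable def chordalCycleCount (G : SimpleGraph V) (u : V) : ℕ :=
  Nat.card {ez : Sym2 V × V //
    ez.1 ∈ G.edgeSet ∧ (∀ x ∈ ez.1, G.Adj u x) ∧
    ez.2 ≠ u ∧ ez.2 ∉ ez.1 ∧ ∀ x ∈ ez.1, G.Adj x ez.2}

noncomputable def pendantTailCount (G : SimpleGraph V) (u : V) : ℕ :=
  Nat.card {ve : V × Sym2 V //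
    G.Adj u ve.1 ∧ ve.2 ∈ G.edgeSet ∧ (∀ x ∈ ve.2, G.Adj ve.1 x) ∧ u ∉ ve.2}

variable [Fintype V] [DecidableEq V] (G : SimpleGraph V) [DecidableRel G.Adj]

theorem aux_tri (u : V) : (2 * (triangleCount G u : ℤ)) =
    ∑ x, ∑ y, (if G.Adj u x then 1 else 0) * (if G.Adj x y then 1 else 0) *
      (if G.Adj y u then (1:ℤ) else 0) := by
  classical
  let H : SimpleGraph V :=
    { Adj := fun x y => G.Adj u x ∧ G.Adj x y ∧ G.Adj y u
      symm := ⟨fun x y h => ⟨h.2.2.symm, h.2.1.symm, h.1.symm⟩⟩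
      loopless := ⟨fun x h => G.loopless.irrefl x h.2.1⟩ }
  have h1 : triangleCount G u = H.edgeFinset.card := by
    unfold triangleCount
    rw [← Set.ncard_coe_finset, ← Nat.card_coe_set_eq]
    refine Nat.card_congr (Equiv.subtypeEquivRight ?_)
    intro e
    induction e using Sym2.ind with
    | _ x y =>
      simp only [SimpleGraph.mem_edgeSet, SimpleGraph.coe_edgeFinset, Sym2.mem_iff, H]
      constructor
      · rintro ⟨a, b⟩
        exact ⟨b x (Or.inl rfl), a, (b y (Or.inr rfl)).symm⟩
      · rintro ⟨a, b, c⟩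
        refine ⟨b, ?_⟩
        rintro z (rfl | rfl)
        · exact a
        · exact c.symm
  have h2 := H.sum_degrees_eq_twice_card_edges
  rw [h1]
  have h3 : (2 * (H.edgeFinset.card : ℤ)) = ((∑ x, H.degree x : ℕ) : ℤ) := by
    rw [h2]; push_cast; rfl
  rw [h3]
  push_cast
  refine Finset.sum_congr rfl fun x _ => ?_
  rw [← SimpleGraph.card_neighborFinset_eq_degree, SimpleGraph.neighborFinset_eq_filter,
    Finset.card_filter]
  push_cast
  refine Finset.sum_congr rfl fun y _ => ?_
  simp only [H]
  by_cases a : G.Adj u x <;> by_cases b : G.Adj x y <;> by_cases c : G.Adj y u <;> simp [a, b, c]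

theorem aux_path (u v : V) (huv : u ≠ v) : (pathCount G 4 u v : ℤ) =
    ∑ y ∈ univ \ {u, v}, ∑ x, ∑ z, if (G.Adj u x ∧ G.Adj x y ∧ G.Adj y z ∧ G.Adj z v ∧
      x ≠ v ∧ z ≠ u ∧ x ≠ z) then (1:ℤ) else 0 := by
  classical
  let S : Finset (V × V × V) := univ.filter fun t =>
      (t.1 ≠ u ∧ t.1 ≠ v) ∧ (G.Adj u t.2.1 ∧ G.Adj t.2.1 t.1 ∧ G.Adj t.1 t.2.2 ∧
      G.Adj t.2.2 v ∧ t.2.1 ≠ v ∧ t.2.2 ≠ u ∧ t.2.1 ≠ t.2.2)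
  have h1 : pathCount G 4 u v = S.card := by
    unfold pathCount
    rw [← Set.ncard_coe_finset, ← Nat.card_coe_set_eq]
    symm
    have key : ∀ t : ((S : Set (V × V × V)) : Type _), (t.1.1 ≠ u ∧ t.1.1 ≠ v) ∧
      (G.Adj u t.1.2.1 ∧ G.Adj t.1.2.1 t.1.1 ∧ G.Adj t.1.1 t.1.2.2 ∧
      G.Adj t.1.2.2 v ∧ t.1.2.1 ≠ v ∧ t.1.2.2 ≠ u ∧ t.1.2.1 ≠ t.1.2.2) := fun t => by
      have := t.2
      simpa only [S, Finset.coe_filter, Set.mem_ofPred_eq, Finset.mem_univ, true_and] using this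
    let f : ((S : Set (V × V × V)) : Type _) → {p : G.Walk u v // p.length = 4 ∧ p.IsPath} := fun t =>
      ⟨Walk.cons (key t).2.1 (Walk.cons (key t).2.2.1 (Walk.cons (key t).2.2.2.1
        (Walk.cons (key t).2.2.2.2.1 Walk.nil))), by
          obtain ⟨⟨a, b⟩, c, d, e, f, g, h, i⟩ := key t
          refine ⟨rfl, ?_⟩
          simp [Walk.cons_isPath_iff, c.ne, d.ne, e.ne, f.ne, a.symm, b, g, h.symm, i, huv]⟩
    refine Nat.card_eq_of_bijective f ⟨?_, ?_⟩
    · rintro ⟨⟨y, x, z⟩, h⟩ ⟨⟨y', x', z'⟩, h'⟩ heq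
      have h2 := congrArg (fun p => p.1.support) heq
      simp [f] at h2
      obtain ⟨rfl, rfl, rfl⟩ := h2
      rfl
    · rintro ⟨p, hl, hp⟩
      match p, hl, hp with
      | .cons (v := x) a (.cons (v := y) b (.cons (v := z) c (.cons d .nil))), hl, hp =>
        refine ⟨⟨(y, x, z), ?_⟩, rfl⟩
        simp [Walk.cons_isPath_iff] at hp
        simp [S]
        grind
  rw [h1]
  simp only [S]
  rw [Finset.card_filter, Fintype.sum_prod_type]
  push_cast
  simp only [Fintype.sum_prod_type]
  rw [← Finset.sum_subset (Finset.subset_univ (univ \ {u, v}))]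
  · refine Finset.sum_congr rfl fun y hy => ?_
    simp at hy
    simp [hy]
  · intro y _ hy
    have : ¬ (y ≠ u ∧ y ≠ v) := by simpa [and_comm] using hy
    simp only [this, false_and, if_false, Finset.sum_const_zero]

theorem aux_card (a b : V) : ((G.neighborFinset a ∩ G.neighborFinset b).card : ℤ) =
    ∑ x, (if G.Adj a x then 1 else 0) * (if G.Adj x b then (1:ℤ) else 0) := by
  have : G.neighborFinset a ∩ G.neighborFinset b =
      univ.filter fun x => G.Adj a x ∧ G.Adj x b := by
    ext x; simp [G.adj_comm]
  rw [this, Finset.card_filter]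
  push_cast
  refine Finset.sum_congr rfl fun x _ => ?_
  by_cases h : G.Adj a x <;> simp [h]

theorem aux_main (u v : V) (huv : u ≠ v) (A : V → V → ℤ)
    (hA : ∀ x y, A x y = if G.Adj x y then 1 else 0) :
    (pathCount G 4 u v : ℤ) =
      ∑ y ∈ univ \ {u, v}, ((∑ x, A u x * A x y) * (∑ z, A y z * A z v)
        - (∑ x, A u x * A x v * A x y)
        - A u v * (∑ z, A v y * A y z * A z v)
        - A u v * (∑ x, A u x * A x y * A y u)
        + A u v * (A u y * A y v)) := by
  rw [aux_path G u v huv]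
  refine Finset.sum_congr rfl fun y hy => ?_
  have hs : ∀ a b, A a b = A b a := fun a b => by simp [hA, G.adj_comm]
  have hsq : ∀ a b, A a b * A a b = A a b := fun a b => by simp [hA]
  have h0 : ∀ a, A a a = 0 := fun a => by simp [hA]
  have e : ∀ x z, (if (G.Adj u x ∧ G.Adj x y ∧ G.Adj y z ∧ G.Adj z v ∧
      x ≠ v ∧ z ≠ u ∧ x ≠ z) then (1:ℤ) else 0) =
      (A u x * A x y) * (A y z * A z v)
      - (if x = z then A u x * A x y * A y x * A x v else 0)
      - (if x = v then A u v * (A v y * A y z * A z v) else 0)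
      - (if z = u then A u v * (A u x * A x y * A y u) else 0)
      + (if x = v then (if z = u then A u v * A v y * A y u * A u v else 0) else 0) := by
    intro x z
    by_cases h1 : x = v
    · subst h1
      by_cases h2 : z = u
      · subst h2
        simp [h0, huv.symm, hs x z]
        ring
      · by_cases h3 : x = z
        · subst h3
          simp [h0, h2]
        · simp [h2, h3]; ring
    · by_cases h2 : z = u
      · subst h2
        by_cases h3 : x = z
        · subst h3
          simp [h0, h1]
        · simp [h1, h3]; ring
      · by_cases h3 : x = z
        · subst h3
          simp [h1, h2]; ring
        · simp [h1, h2, h3, hA]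
          by_cases a : G.Adj u x <;> by_cases b : G.Adj x y <;> by_cases c : G.Adj y z <;>
            by_cases d : G.Adj z v <;> simp [a, b, c, d]
  simp only [e, Finset.sum_add_distrib, Finset.sum_sub_distrib, Finset.sum_ite_eq,
    Finset.mem_univ, if_true]
  rw [Finset.sum_mul_sum]
  have t1 : ∀ x, A u x * A x y * A y x * A x v = A u x * A x v * A x y := fun x => by
    rw [hs y x]; linear_combination A u x * A x v * hsq x y
  have t2 : ∀ F : V → ℤ, (∑ x, ∑ z, if x = v then F z else 0) = ∑ z, F z := fun F => by
    rw [Finset.sum_comm]; simp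
  have t3 : ∀ F : V → ℤ, (∑ x, ∑ z, if z = u then F x else 0) = ∑ x, F x := fun F => by
    simp
  have t4 : ∀ c : ℤ, (∑ x, ∑ z, if x = v then (if z = u then c else 0) else 0) = c := fun c => by
    rw [Finset.sum_comm]; simp
  rw [t2, t3, t4]
  simp only [t1, ← Finset.mul_sum]
  rw [hs v y, hs y u]
  linear_combination (A y v * A u y) * hsq u v

/-- The formula for `P_4(u,v)` for distinct vertices `u`, `v`. -/
theorem pathCount_four_eq (u v : V) (huv : u ≠ v) :
    (pathCount G 4 u v : ℤ) =
      (∑ y ∈ univ \ {u, v},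
          ((G.neighborFinset u ∩ G.neighborFinset y).card : ℤ) *
            ((G.neighborFinset y ∩ G.neighborFinset v).card : ℤ))
      - (∑ x ∈ G.neighborFinset u ∩ G.neighborFinset v, ((G.degree x : ℤ) - 2))
      - (if G.Adj u v then 1 else 0) *
          (2 * (triangleCount G u : ℤ) + 2 * (triangleCount G v : ℤ) -
            3 * ((G.neighborFinset u ∩ G.neighborFinset v).card : ℤ)) := by
  classical
  obtain ⟨A, hA⟩ : ∃ A : V → V → ℤ, ∀ x y, A x y = if G.Adj x y then 1 else 0 := ⟨_, fun _ _ => rfl⟩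
  have hs : ∀ a b, A a b = A b a := fun a b => by simp [hA, G.adj_comm]
  have hsq : ∀ a b, A a b * A a b = A a b := fun a b => by simp [hA]
  have h0 : ∀ a, A a a = 0 := fun a => by simp [hA]
  rw [aux_main G u v huv A hA, aux_tri, aux_tri]
  have hd : ∑ x ∈ G.neighborFinset u ∩ G.neighborFinset v, ((G.degree x : ℤ) - 2) =
      ∑ x, A u x * A x v * ((∑ y, A x y) - 2) := by
    have : G.neighborFinset u ∩ G.neighborFinset v =
        univ.filter fun x => G.Adj u x ∧ G.Adj x v := by
      ext x; simp [G.adj_comm]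
    rw [this, Finset.sum_filter]
    refine Finset.sum_congr rfl fun x _ => ?_
    rw [← SimpleGraph.card_neighborFinset_eq_degree, SimpleGraph.neighborFinset_eq_filter,
      Finset.card_filter]
    push_cast
    simp only [hA]
    by_cases a : G.Adj u x <;> by_cases b : G.Adj x v <;> simp [a, b]
  rw [hd]
  simp only [aux_card, ← hA]
  simp only [Finset.sum_add_distrib, Finset.sum_sub_distrib, ← Finset.mul_sum]
  have hsd : ∀ F : V → ℤ, ∑ y ∈ univ \ {u, v}, F y = (∑ y, F y) - F u - F v := fun F => by
    have := Finset.sum_sdiff (f := F) (Finset.subset_univ ({u, v} : Finset V))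
    rw [Finset.sum_pair huv] at this
    linarith
  have e1 : ∑ y ∈ univ \ {u, v}, ∑ x, A u x * A x v * A x y =
      ∑ x, A u x * A x v * ((∑ y, A x y) - 2) := by
    rw [Finset.sum_comm]
    refine Finset.sum_congr rfl fun x _ => ?_
    rw [← Finset.mul_sum, hsd, hs x u]
    linear_combination (-A x v) * hsq u x - A u x * hsq x v
  have e2 : ∑ y ∈ univ \ {u, v}, A v y * ∑ z, A y z * A z v =
      (∑ x, ∑ y, A v x * A x y * A y v) - A v u * ∑ z, A u z * A z v := by
    rw [hsd]
    simp [h0, Finset.mul_sum, mul_assoc]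
  have e3 : ∑ y ∈ univ \ {u, v}, ∑ x, A u x * A x y * A y u =
      (∑ x, ∑ y, A u x * A x y * A y u) - A v u * ∑ z, A u z * A z v := by
    rw [hsd, Finset.sum_comm]
    simp [h0, Finset.mul_sum, mul_comm]
  have e4 : ∑ y ∈ univ \ {u, v}, A u y * A y v = ∑ z, A u z * A z v := by
    rw [hsd]; simp [h0]
  simp only [mul_assoc, ← Finset.mul_sum] at e1 e2 e3 e4 ⊢
  rw [e1, e2, e3, e4, hs v u]
  linear_combination (2 * ∑ z, A u z * A z v) * hsq u v
end

section
/- For any two distinct vertices u, v of a finite simple graph G, the following identity holds in ℤ: C_{2,3}(u,v) = |N(u)∩N(v)|·P_3(u,v) − T(u,v) − T(v,u). -/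
/-!
Counting quantities for a (finite) simple graph `G`:

* `walkCount G k u v` = `W_k(u,v)`, the number of `k`-walks from `u` to `v`;
* `pathCount G k u v` = `P_k(u,v)`, the number of `k`-paths from `u` to `v`;
* `cycleWalkCount G ℓ u` = the number of closed walks of length `ℓ` based at `u`
  that are cycles; by definition `C_ℓ(u)` is half this number, so this quantity
  is exactly `2·C_ℓ(u)`;
* `triangleCount G u` = `C_3(u)`, the number of unordered pairs `{x,y} ⊆ N(u)`
  with `x` adjacent to `y` (equivalently, edges of `G` whose two endpoints are
  both neighbors of `u`);
* `pairPathCount G k l u v` = `C_{k,l}(u,v)`, the number of ordered pairs `(p,q)`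
  where `p` is a `k`-path from `u` to `v`, `q` is an `l`-path from `u` to `v`,
  and `p`, `q` share no vertices other than `u` and `v`;
* `tailedTriangleCount G u v` = `T(u,v)`;
* `triangleRectangleCount G u v` = `TR_1(u,v)`;
* `chordalCycleCount G u` = `CC_1(u)`;
* `pendantTailCount G u` = the number of tailed triangles with pendant vertex `u`.
-/

open SimpleGraph Finset

variable {V : Type*}

theorem aux_pathCount (G : SimpleGraph V) (u v : V) (huv : u ≠ v) :
    pathCount G 3 u v = Nat.card {t : V × V // G.Adj u t.1 ∧ G.Adj t.1 t.2 ∧ G.Adj t.2 v ∧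
      t.1 ≠ v ∧ t.2 ≠ u} := by
  symm
  refine Nat.card_eq_of_bijective
    (fun t => ⟨Walk.cons t.2.1 (Walk.cons t.2.2.1 (Walk.cons t.2.2.2.1 Walk.nil)), ?_⟩) ⟨?_, ?_⟩
  · obtain ⟨⟨x, y⟩, h1, h2, h3, h4, h5⟩ := t
    have := h1.ne
    have := h2.ne
    have := h3.ne
    refine ⟨rfl, ?_⟩
    simp_all [Walk.cons_isPath_iff]
    tauto
  · rintro ⟨⟨x, y⟩, h⟩ ⟨⟨x', y'⟩, h'⟩ e
    have := congrArg Walk.support (congrArg Subtype.val e)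
    simp at this
    simp [this]
  · rintro ⟨p, hl, hp⟩
    match p, hl, hp with
    | .cons (v := x) h1 (.cons (v := y) h2 (.cons h3 .nil)), hl, hp =>
      refine ⟨⟨(x, y), h1, h2, h3, ?_, ?_⟩, rfl⟩
      · rintro rfl
        simp [Walk.cons_isPath_iff] at hp
      · rintro rfl
        simp [Walk.cons_isPath_iff] at hp

theorem aux_pair (G : SimpleGraph V) (u v : V) (huv : u ≠ v) :
    pairPathCount G 2 3 u v = Nat.card {t : V × V × V // (G.Adj u t.1 ∧ G.Adj t.1 v) ∧
      (G.Adj u t.2.1 ∧ G.Adj t.2.1 t.2.2 ∧ G.Adj t.2.2 v ∧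
      t.2.1 ≠ v ∧ t.2.2 ≠ u) ∧ t.1 ≠ t.2.1 ∧ t.1 ≠ t.2.2} := by
  symm
  refine Nat.card_eq_of_bijective
    (fun t => ⟨(Walk.cons t.2.1.1 (Walk.cons t.2.1.2 Walk.nil),
      Walk.cons t.2.2.1.1 (Walk.cons t.2.2.1.2.1 (Walk.cons t.2.2.1.2.2.1 Walk.nil))), ?_⟩)
    ⟨?_, ?_⟩
  · obtain ⟨⟨w, x, y⟩, ⟨a1, a2⟩, ⟨h1, h2, h3, h4, h5⟩, n1, n2⟩ := t
    have := h1.ne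
    have := h2.ne
    have := h3.ne
    have := a1.ne
    have := a2.ne
    refine ⟨rfl, ?_, rfl, ?_, ?_⟩
    · simp_all [Walk.cons_isPath_iff]
    · simp_all [Walk.cons_isPath_iff]
      tauto
    · simp_all
  · rintro ⟨⟨w, x, y⟩, h⟩ ⟨⟨w', x', y'⟩, h'⟩ e
    have e1 := congrArg Walk.support (congrArg Prod.fst (congrArg Subtype.val e))
    have e2 := congrArg Walk.support (congrArg Prod.snd (congrArg Subtype.val e))
    simp at e1 e2
    simp [e1, e2]
  · rintro ⟨⟨p, q⟩, hl, hp, hm, hq, hd⟩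
    match p, hl, hp, q, hm, hq, hd with
    | .cons (v := w) a1 (.cons a2 .nil), hl, hp,
      .cons (v := x) h1 (.cons (v := y) h2 (.cons h3 .nil)), hm, hq, hd =>
      have hw := hd w (by simp)
      have e1 := a1.ne
      have e2 := a2.ne
      refine ⟨⟨(w, x, y), ⟨a1, a2⟩, ⟨h1, h2, h3, ?_, ?_⟩, ?_, ?_⟩, rfl⟩
      · rintro rfl
        simp [Walk.cons_isPath_iff] at hq
      · rintro rfl
        simp [Walk.cons_isPath_iff] at hq
      · intro e
        rcases hw (by simp at e; simp [e]) with r | r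
        · exact e1 r.symm
        · exact e2 r
      · intro e
        rcases hw (by simp at e; simp [e]) with r | r
        · exact e1 r.symm
        · exact e2 r

variable [Fintype V] [DecidableEq V] (G : SimpleGraph V) [DecidableRel G.Adj]

/-- `C_{2,3}(u,v) = |N(u)∩N(v)|·P_3(u,v) − T(u,v) − T(v,u)` for distinct `u`, `v`. -/
theorem pairPathCount_two_three_eq (u v : V) (huv : u ≠ v) :
    (pairPathCount G 2 3 u v : ℤ) =
      ((G.neighborFinset u ∩ G.neighborFinset v).card : ℤ) * (pathCount G 3 u v : ℤ)
      - (tailedTriangleCount G u v : ℤ) - (tailedTriangleCount G v u : ℤ) := by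
  classical
  rw [aux_pair G u v huv, aux_pathCount G u v huv]
  unfold tailedTriangleCount
  simp only [Nat.card_eq_fintype_card, Fintype.card_subtype]
  set P := (Finset.univ.filter fun t : V × V => G.Adj u t.1 ∧ G.Adj t.1 t.2 ∧ G.Adj t.2 v ∧
      t.1 ≠ v ∧ t.2 ≠ u) with hP
  set N := G.neighborFinset u ∩ G.neighborFinset v with hN
  have key := Finset.card_product N P
  have s1 := Finset.card_filter_add_card_filter_not (s := N ×ˢ P) (fun t => t.1 = t.2.1)
  have s2 := Finset.card_filter_add_card_filter_not
    (s := (N ×ˢ P).filter (fun t => ¬ t.1 = t.2.1)) (fun t => t.1 = t.2.2)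
  have b1 : ((N ×ˢ P).filter (fun t => t.1 = t.2.1)).card = (Finset.univ.filter
      fun wz : V × V => wz.1 ≠ wz.2 ∧ wz.1 ≠ u ∧ wz.1 ≠ v ∧ wz.2 ≠ u ∧ wz.2 ≠ v ∧
      G.Adj wz.1 u ∧ G.Adj wz.1 v ∧ G.Adj wz.1 wz.2 ∧ G.Adj wz.2 v).card := by
    refine Finset.card_bij' (fun t _ => t.2) (fun t _ => (t.1, t)) ?_ ?_ ?_ ?_
    · rintro ⟨w, x, y⟩ h
      simp [hP, hN] at h ⊢
      grind [SimpleGraph.Adj.ne, SimpleGraph.Adj.symm]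
    · rintro ⟨x, y⟩ h
      simp [hP, hN] at h ⊢
      grind [SimpleGraph.Adj.ne, SimpleGraph.Adj.symm]
    · rintro ⟨w, x, y⟩ h
      simp at h ⊢
      exact h.2.symm
    · rintro ⟨x, y⟩ h
      rfl
  have b2 : (((N ×ˢ P).filter (fun t => ¬ t.1 = t.2.1)).filter (fun t => t.1 = t.2.2)).card =
      (Finset.univ.filter
      fun wz : V × V => wz.1 ≠ wz.2 ∧ wz.1 ≠ v ∧ wz.1 ≠ u ∧ wz.2 ≠ v ∧ wz.2 ≠ u ∧
      G.Adj wz.1 v ∧ G.Adj wz.1 u ∧ G.Adj wz.1 wz.2 ∧ G.Adj wz.2 u).card := by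
    refine Finset.card_bij' (fun t _ => (t.2.2, t.2.1)) (fun t _ => (t.1, t.2, t.1)) ?_ ?_ ?_ ?_
    · rintro ⟨w, x, y⟩ h
      simp [hP, hN] at h ⊢
      grind [SimpleGraph.Adj.ne, SimpleGraph.Adj.symm]
    · rintro ⟨x, y⟩ h
      simp [hP, hN] at h ⊢
      grind [SimpleGraph.Adj.ne, SimpleGraph.Adj.symm]
    · rintro ⟨w, x, y⟩ h
      simp at h ⊢
      exact h.2.symm
    · rintro ⟨x, y⟩ h
      rfl
  have b3 : (((N ×ˢ P).filter (fun t => ¬ t.1 = t.2.1)).filter (fun t => ¬ t.1 = t.2.2)) =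
      (Finset.univ.filter fun t : V × V × V => (G.Adj u t.1 ∧ G.Adj t.1 v) ∧
      (G.Adj u t.2.1 ∧ G.Adj t.2.1 t.2.2 ∧ G.Adj t.2.2 v ∧
      t.2.1 ≠ v ∧ t.2.2 ≠ u) ∧ t.1 ≠ t.2.1 ∧ t.1 ≠ t.2.2) := by
    ext ⟨w, x, y⟩
    simp [hP, hN, G.adj_comm v w]
    tauto
  rw [← b3, ← b1, ← b2, ← Nat.cast_mul, ← key, ← s1, ← s2]
  push_cast
  ring
end

section
/- For any two adjacent vertices u, v of a finite simple graph G, the following identity holds in ℤ: TR_1(u,v) = Σ_{x ∈ N(u)∩N(v)} P_3(x,v) − Σ_{x ∈ N(u)∩N(v)} (|N(u)∩N(x)| − 1) − |N(u)∩N(v)|·(|N(u)∩N(v)| − 1). -/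
/-!
Counting quantities for a (finite) simple graph `G`:

* `walkCount G k u v` = `W_k(u,v)`, the number of `k`-walks from `u` to `v`;
* `pathCount G k u v` = `P_k(u,v)`, the number of `k`-paths from `u` to `v`;
* `cycleWalkCount G ℓ u` = the number of closed walks of length `ℓ` based at `u`
  that are cycles; by definition `C_ℓ(u)` is half this number, so this quantity
  is exactly `2·C_ℓ(u)`;
* `triangleCount G u` = `C_3(u)`, the number of unordered pairs `{x,y} ⊆ N(u)`
  with `x` adjacent to `y` (equivalently, edges of `G` whose two endpoints are
  both neighbors of `u`);
* `pairPathCount G k l u v` = `C_{k,l}(u,v)`, the number of ordered pairs `(p,q)`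
  where `p` is a `k`-path from `u` to `v`, `q` is an `l`-path from `u` to `v`,
  and `p`, `q` share no vertices other than `u` and `v`;
* `tailedTriangleCount G u v` = `T(u,v)`;
* `triangleRectangleCount G u v` = `TR_1(u,v)`;
* `chordalCycleCount G u` = `CC_1(u)`;
* `pendantTailCount G u` = the number of tailed triangles with pendant vertex `u`.
-/

open SimpleGraph Finset

variable {V : Type*}

theorem pathCount_three_aux {V : Type*} [Fintype V] [DecidableEq V] (G : SimpleGraph V)
    [DecidableRel G.Adj] (x v : V) (hxv : x ≠ v) :
    pathCount G 3 x v = (Finset.univ.filter (fun q : V × V =>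
      G.Adj x q.1 ∧ G.Adj q.1 q.2 ∧ G.Adj q.2 v ∧ x ≠ q.2 ∧ q.1 ≠ v)).card := by
  rw [← Fintype.card_subtype, ← Nat.card_eq_fintype_card, pathCount]
  symm
  refine Nat.card_congr (Equiv.ofBijective (fun q => ⟨Walk.cons q.2.1 (Walk.cons q.2.2.1
    (Walk.cons q.2.2.2.1 Walk.nil)), ?_, ?_⟩) ⟨?_, ?_⟩)
  · simp
  · obtain ⟨⟨b, a⟩, h1, h2, h3, h4, h5⟩ := q
    have := h1.ne
    have := h2.ne
    have := h3.ne
    simp_all [Walk.cons_isPath_iff]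
  · rintro ⟨⟨b, a⟩, h⟩ ⟨⟨b', a'⟩, h'⟩ he
    have := congrArg (fun p => p.1.support) he
    simp at this
    simp [this]
  · rintro ⟨p, hl, hp⟩
    match p, hl, hp with
    | Walk.cons (v := b) h1 (Walk.cons (v := a) h2 (Walk.cons h3 Walk.nil)), hl, hp =>
      simp [Walk.cons_isPath_iff] at hp
      exact ⟨⟨(b, a), h1, h2, h3, by tauto, by tauto⟩, rfl⟩

theorem pathCount_three_split {V : Type*} [Fintype V] [DecidableEq V] (G : SimpleGraph V)
    [DecidableRel G.Adj] (u x v : V) (huv : G.Adj u v) (hx : G.Adj u x) (hv : G.Adj v x) :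
    (pathCount G 3 x v : ℤ) = ((Finset.univ.filter (fun q : V × V =>
      G.Adj x q.2 ∧ G.Adj q.2 q.1 ∧ G.Adj q.1 v ∧ x ≠ q.1 ∧ q.2 ≠ v ∧ q.1 ≠ u ∧ q.2 ≠ u)).card : ℤ)
      + (((G.neighborFinset u ∩ G.neighborFinset x).card : ℤ) - 1)
      + (((G.neighborFinset u ∩ G.neighborFinset v).card : ℤ) - 1) := by
  have hvm : v ∈ G.neighborFinset u ∩ G.neighborFinset x := by simp [huv, hv.symm]
  have hxm : x ∈ G.neighborFinset u ∩ G.neighborFinset v := by simp [hx, hv]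
  have e1 := Finset.card_erase_add_one hvm
  have e2 := Finset.card_erase_add_one hxm
  have key : pathCount G 3 x v = (Finset.univ.filter (fun q : V × V =>
      G.Adj x q.2 ∧ G.Adj q.2 q.1 ∧ G.Adj q.1 v ∧ x ≠ q.1 ∧ q.2 ≠ v ∧ q.1 ≠ u ∧ q.2 ≠ u)).card
      + ((G.neighborFinset u ∩ G.neighborFinset x).erase v).card
      + ((G.neighborFinset u ∩ G.neighborFinset v).erase x).card := by
    rw [pathCount_three_aux G x v hv.ne']
    rw [← Finset.card_image_of_injective (Finset.univ.filter (fun q : V × V =>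
      G.Adj x q.2 ∧ G.Adj q.2 q.1 ∧ G.Adj q.1 v ∧ x ≠ q.1 ∧ q.2 ≠ v ∧ q.1 ≠ u ∧ q.2 ≠ u))
        (f := Prod.swap) Prod.swap_injective,
      ← Finset.card_image_of_injective ((G.neighborFinset u ∩ G.neighborFinset x).erase v)
        (f := fun b => (b, u)) (fun a b h => by simpa using h),
      ← Finset.card_image_of_injective ((G.neighborFinset u ∩ G.neighborFinset v).erase x)
        (f := fun b => (u, b)) (fun a b h => by simpa using h),
      ← Finset.card_union_of_disjoint, ← Finset.card_union_of_disjoint]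
    · congr 1
      ext ⟨b, a⟩
      simp only [Finset.mem_filter, Finset.mem_univ, true_and, Finset.mem_union,
        Finset.mem_image, Finset.mem_erase, Finset.mem_inter, mem_neighborFinset, Prod.exists,
        Prod.swap_prod_mk, Prod.mk.injEq]
      grind [SimpleGraph.adj_comm, SimpleGraph.irrefl]
    · rw [Finset.disjoint_left]
      rintro ⟨b, a⟩ h h'
      simp only [Finset.mem_filter, Finset.mem_univ, true_and, Finset.mem_union,
        Finset.mem_image, Finset.mem_erase, Finset.mem_inter, mem_neighborFinset, Prod.exists,
        Prod.mk.injEq] at h h'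
      grind [SimpleGraph.irrefl]
    · rw [Finset.disjoint_left]
      rintro ⟨b, a⟩ h h'
      simp only [Finset.mem_filter, Finset.mem_univ, true_and, Finset.mem_union,
        Finset.mem_image, Finset.mem_erase, Finset.mem_inter, mem_neighborFinset, Prod.exists,
        Prod.swap_prod_mk, Prod.mk.injEq] at h h'
      grind
  omega

variable [Fintype V] [DecidableEq V] (G : SimpleGraph V) [DecidableRel G.Adj]

/-- The formula for `TR_1(u,v)` for adjacent vertices `u`, `v`. -/
theorem triangleRectangleCount_eq (u v : V) (huv : G.Adj u v) :
    (triangleRectangleCount G u v : ℤ) =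
      (∑ x ∈ G.neighborFinset u ∩ G.neighborFinset v, (pathCount G 3 x v : ℤ))
      - (∑ x ∈ G.neighborFinset u ∩ G.neighborFinset v,
          (((G.neighborFinset u ∩ G.neighborFinset x).card : ℤ) - 1))
      - ((G.neighborFinset u ∩ G.neighborFinset v).card : ℤ) *
          (((G.neighborFinset u ∩ G.neighborFinset v).card : ℤ) - 1) := by
  have hT : triangleRectangleCount G u v =
      ∑ x ∈ G.neighborFinset u ∩ G.neighborFinset v, (Finset.univ.filter (fun q : V × V =>
      G.Adj x q.2 ∧ G.Adj q.2 q.1 ∧ G.Adj q.1 v ∧ x ≠ q.1 ∧ q.2 ≠ v ∧ q.1 ≠ u ∧ q.2 ≠ u)).card := by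
    rw [← Finset.card_sigma, triangleRectangleCount, Nat.card_eq_fintype_card,
      Fintype.card_subtype]
    refine Finset.card_bij' (fun t _ => ⟨t.1, t.2⟩) (fun s _ => (s.1, s.2)) ?_ ?_ ?_ ?_
    · rintro ⟨x, a, b⟩ h
      simp only [Finset.mem_filter, Finset.mem_univ, true_and, Finset.mem_sigma,
        Finset.mem_inter, mem_neighborFinset] at h ⊢
      grind [SimpleGraph.adj_comm]
    · rintro ⟨x, a, b⟩ h
      simp only [Finset.mem_filter, Finset.mem_univ, true_and, Finset.mem_sigma,
        Finset.mem_inter, mem_neighborFinset] at h ⊢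
      obtain ⟨⟨h1, h2⟩, h3, h4, h5, h6, h7, h8, h9⟩ := h
      exact ⟨⟨h6, h3.ne, h4.ne'⟩, ⟨h1.ne', h2.ne', h8, h5.ne, h9, h7⟩, h1, h2, h5.symm, h4.symm,
        h3.symm⟩
    · intros; rfl
    · intros; rfl
  rw [hT, Finset.sum_congr rfl (fun x hx => pathCount_three_split G u x v huv
    (by simpa using (Finset.mem_inter.1 hx).1) (by simpa using (Finset.mem_inter.1 hx).2))]
  rw [Finset.sum_add_distrib, Finset.sum_add_distrib, Finset.sum_const, nsmul_eq_mul]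
  push_cast
  ring
end

section
/- For every vertex u of a finite simple graph G: 2·CC_1(u) = Σ_{v ∈ N(u)} Σ_{x ∈ N(u)∩N(v)} (|N(v)∩N(x)| − 1). -/
/-!
Counting quantities for a (finite) simple graph `G`:

* `walkCount G k u v` = `W_k(u,v)`, the number of `k`-walks from `u` to `v`;
* `pathCount G k u v` = `P_k(u,v)`, the number of `k`-paths from `u` to `v`;
* `cycleWalkCount G ℓ u` = the number of closed walks of length `ℓ` based at `u`
  that are cycles; by definition `C_ℓ(u)` is half this number, so this quantity
  is exactly `2·C_ℓ(u)`;
* `triangleCount G u` = `C_3(u)`, the number of unordered pairs `{x,y} ⊆ N(u)`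
  with `x` adjacent to `y` (equivalently, edges of `G` whose two endpoints are
  both neighbors of `u`);
* `pairPathCount G k l u v` = `C_{k,l}(u,v)`, the number of ordered pairs `(p,q)`
  where `p` is a `k`-path from `u` to `v`, `q` is an `l`-path from `u` to `v`,
  and `p`, `q` share no vertices other than `u` and `v`;
* `tailedTriangleCount G u v` = `T(u,v)`;
* `triangleRectangleCount G u v` = `TR_1(u,v)`;
* `chordalCycleCount G u` = `CC_1(u)`;
* `pendantTailCount G u` = the number of tailed triangles with pendant vertex `u`.
-/

open SimpleGraph Finset

variable {V : Type*}

variable [Fintype V] [DecidableEq V] (G : SimpleGraph V) [DecidableRel G.Adj]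

/-- `2·CC_1(u) = Σ_{v ∈ N(u)} Σ_{x ∈ N(u)∩N(v)} (|N(v)∩N(x)| − 1)`. -/
theorem two_mul_chordalCycleCount (u : V) :
    (2 * chordalCycleCount G u : ℤ) =
      ∑ v ∈ G.neighborFinset u, ∑ x ∈ G.neighborFinset u ∩ G.neighborFinset v,
        (((G.neighborFinset v ∩ G.neighborFinset x).card : ℤ) - 1) := by
  classical
  set S : Finset (Sym2 V × V) := Finset.univ.filter (fun ez : Sym2 V × V =>
    ez.1 ∈ G.edgeSet ∧ (∀ x ∈ ez.1, G.Adj u x) ∧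
    ez.2 ≠ u ∧ ez.2 ∉ ez.1 ∧ ∀ x ∈ ez.1, G.Adj x ez.2) with hS
  have h1 : chordalCycleCount G u = S.card := by
    unfold chordalCycleCount
    rw [Nat.card_eq_fintype_card, Fintype.card_subtype]
  set T : Finset ((_ : V) × (_ : V) × V) := (G.neighborFinset u).sigma (fun v =>
    (G.neighborFinset u ∩ G.neighborFinset v).sigma (fun x =>
      (G.neighborFinset v ∩ G.neighborFinset x).erase u)) with hT
  have h2 : (T.card : ℤ) = ∑ v ∈ G.neighborFinset u,
      ∑ x ∈ G.neighborFinset u ∩ G.neighborFinset v,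
        (((G.neighborFinset v ∩ G.neighborFinset x).card : ℤ) - 1) := by
    rw [hT, Finset.card_sigma]
    push_cast
    refine Finset.sum_congr rfl fun v hv => ?_
    rw [Finset.card_sigma]
    push_cast
    refine Finset.sum_congr rfl fun x hx => ?_
    have hu : u ∈ G.neighborFinset v ∩ G.neighborFinset x := by
      simp only [Finset.mem_inter, mem_neighborFinset] at hv hx ⊢
      exact ⟨hv.symm, hx.1.symm⟩
    have := Finset.card_erase_add_one hu
    omega
  have memT : ∀ a b z : V, (⟨a, b, z⟩ : (_ : V) × (_ : V) × V) ∈ T ↔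
      G.Adj u a ∧ (G.Adj u b ∧ G.Adj a b) ∧ z ≠ u ∧ G.Adj a z ∧ G.Adj b z := by
    intro a b z
    simp [hT]
  have memS : ∀ a b z : V, (s(a, b), z) ∈ S ↔
      G.Adj u a ∧ (G.Adj u b ∧ G.Adj a b) ∧ z ≠ u ∧ G.Adj a z ∧ G.Adj b z := by
    intro a b z
    simp only [hS, Finset.mem_filter, Finset.mem_univ, true_and, mem_edgeSet, Sym2.mem_iff,
      forall_eq_or_imp, forall_eq, not_or]
    constructor
    · tauto
    · rintro ⟨h1, ⟨h2, h3⟩, h4, h5, h6⟩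
      exact ⟨h3, ⟨h1, h2⟩, h4, ⟨h5.ne.symm, h6.ne.symm⟩, h5, h6⟩
  let f : ((_ : V) × (_ : V) × V) → Sym2 V × V := fun t => (s(t.1, t.2.1), t.2.2)
  have h3 : T.card = ∑ e ∈ S, (T.filter (fun t => f t = e)).card := by
    apply Finset.card_eq_sum_card_fiberwise
    rintro ⟨a, b, z⟩ h
    exact (memS a b z).2 ((memT a b z).1 h)
  have h4 : ∀ e ∈ S, (T.filter (fun t => f t = e)).card = 2 := by
    rintro ⟨e, z⟩ he
    induction e using Sym2.ind with
    | _ a b =>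
    have hm := (memS a b z).1 he
    have hab : a ≠ b := hm.2.1.2.ne
    have : T.filter (fun t => f t = (s(a, b), z)) = {⟨a, b, z⟩, ⟨b, a, z⟩} := by
      ext ⟨c, d, w⟩
      rw [Finset.mem_filter, memT]
      simp only [f, Prod.mk.injEq, Sym2.eq_iff, Finset.mem_insert, Finset.mem_singleton,
        Sigma.mk.injEq, heq_eq_eq]
      constructor
      · tauto
      · have := hm.2.1.2.symm
        rintro (⟨rfl, rfl, rfl⟩ | ⟨rfl, rfl, rfl⟩) <;> tauto
    rw [this, Finset.card_pair]
    intro h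
    simp only [Sigma.mk.injEq] at h
    exact hab h.1
  rw [Finset.sum_congr rfl h4, Finset.sum_const, smul_eq_mul] at h3
  rw [← h2, h1, h3]
  push_cast
  ring
end
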